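/- (Analytic kernel of Theorem 2) Under the holonomic system hypotheses with the conformally flat constant-mean-curvature ansatz, if H = 0 and c ≠ 0, then v1 = v3 everywhere on U, and consequently V2 = 0 everywhere on U (i.e. the middle principal curvature vanishes identically). -/

import Mathlib

noncomputable section

/-- Partial derivative of `f : ℝ³ → ℝ` in the `i`-th coordinate direction `u_{i+1}`. -/
noncomputable def pd (i : Fin 3) (f : (Fin 3 → ℝ) → ℝ) (p : Fin 3 → ℝ) : ℝ :=
  fderiv ℝ f p (Pi.single i 1)

/-- `hh v i j p = h_{ij}(p) = (1/v_i) ∂v_j/∂u_i` (indices shifted down by one: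
`v 0, v 1, v 2` are `v₁, v₂, v₃` and directions `0,1,2` are `u₁,u₂,u₃`). -/
noncomputable def hh (v : Fin 3 → (Fin 3 → ℝ) → ℝ) (i j : Fin 3) (p : Fin 3 → ℝ) : ℝ :=
  (1 / v i p) * pd i (v j) p

/-- `al v 0 = α₁ = (1/v₂)∂v₂/∂u₁`, `al v 1 = α₂ = (1/v₃)∂v₃/∂u₂`,
`al v 2 = α₃ = (1/v₁)∂v₁/∂u₃`. -/
noncomputable def al (v : Fin 3 → (Fin 3 → ℝ) → ℝ) (i : Fin 3) (p : Fin 3 → ℝ) : ℝ :=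
  (1 / v (i + 1) p) * pd i (v (i + 1)) p

/-- The holonomic system hypotheses together with the conformally flat
constant-mean-curvature ansatz, on a connected open set `U ⊆ ℝ³`. -/
structure Hypo (U : Set (Fin 3 → ℝ)) (v V : Fin 3 → (Fin 3 → ℝ) → ℝ) (c H : ℝ) : Prop where
  hopen : IsOpen U
  hconn : IsConnected U
  smooth_v : ∀ i, ContDiffOn ℝ (⊤ : ℕ∞) (v i) U
  smooth_V : ∀ i, ContDiffOn ℝ (⊤ : ℕ∞) (V i) U
  pos : ∀ i, ∀ p ∈ U, 0 < v i p
  holi : ∀ i j, i ≠ j → ∀ p ∈ U, pd j (v i) p = hh v j i p * v j p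
  holii : ∀ i j k, i ≠ j → j ≠ k → i ≠ k → ∀ p ∈ U,
    pd j (hh v i k) p = hh v i j p * hh v j k p
  holiii : ∀ i j k, i ≠ j → j ≠ k → i ≠ k → ∀ p ∈ U,
    pd i (hh v i j) p + pd j (hh v j i) p + hh v k i p * hh v k j p
      + V i p * V j p + c * v i p * v j p = 0
  holiv : ∀ i j, i ≠ j → ∀ p ∈ U, pd j (V i) p = hh v j i p * V j p
  ansatz_v : ∀ p ∈ U, (v 1 p) ^ 2 = (v 0 p) ^ 2 + (v 2 p) ^ 2
  ansatz_V1 : ∀ p ∈ U, V 0 p = -(1/3) * (v 1 p / v 2 p + v 2 p / v 1 p) + (v 0 p / 3) * H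
  ansatz_V2 : ∀ p ∈ U, V 1 p = -(1/3) * (v 0 p / v 2 p - v 2 p / v 0 p) + (v 1 p / 3) * H
  ansatz_V3 : ∀ p ∈ U, V 2 p = (1/3) * (v 0 p / v 1 p + v 1 p / v 0 p) + (v 2 p / 3) * H

/-- The line `s ↦ p + s • eᵢ` stays in an open set for small `s`. -/
lemma eventually_line_mem {U : Set (Fin 3 → ℝ)} (hU : IsOpen U) {p : Fin 3 → ℝ} (hp : p ∈ U)
    (i : Fin 3) : ∀ᶠ s : ℝ in nhds 0, p + s • (Pi.single i 1 : Fin 3 → ℝ) ∈ U := by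
  have hc : Continuous fun s : ℝ => p + s • (Pi.single i 1 : Fin 3 → ℝ) := by fun_prop
  exact hc.continuousAt.eventually_mem (hU.mem_nhds (by simpa using hp))

/-- `pd i f` is the derivative of `f` along the `i`-th coordinate line. -/
lemma hasDerivAt_line {U : Set (Fin 3 → ℝ)} (hU : IsOpen U) {f : (Fin 3 → ℝ) → ℝ}
    (hf : ContDiffOn ℝ (⊤ : ℕ∞) f U) {p : Fin 3 → ℝ} (hp : p ∈ U) (i : Fin 3) :
    HasDerivAt (fun s : ℝ => f (p + s • (Pi.single i 1 : Fin 3 → ℝ))) (pd i f p) 0 := by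
  have hd : DifferentiableAt ℝ f p :=
    (hf.contDiffAt (hU.mem_nhds hp)).differentiableAt (by simp)
  exact hd.hasFDerivAt.hasLineDerivAt _

/-- Two functions agreeing on an open set have the same derivative along coordinate lines. -/
lemma line_deriv_unique {U : Set (Fin 3 → ℝ)} (hU : IsOpen U) {f g : (Fin 3 → ℝ) → ℝ}
    (hfg : ∀ q ∈ U, f q = g q) {p : Fin 3 → ℝ} (hp : p ∈ U) (i : Fin 3) {a b : ℝ}
    (hf : HasDerivAt (fun s : ℝ => f (p + s • (Pi.single i 1 : Fin 3 → ℝ))) a 0)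
    (hg : HasDerivAt (fun s : ℝ => g (p + s • (Pi.single i 1 : Fin 3 → ℝ))) b 0) : a = b := by
  refine hf.unique (hg.congr_of_eventuallyEq ?_)
  filter_upwards [eventually_line_mem hU hp i] with s hs using hfg _ hs

lemma contDiffOn_pd {U : Set (Fin 3 → ℝ)} (hU : IsOpen U) {f : (Fin 3 → ℝ) → ℝ}
    (hf : ContDiffOn ℝ (⊤ : ℕ∞) f U) (i : Fin 3) : ContDiffOn ℝ (⊤ : ℕ∞) (pd i f) U :=
  (hf.fderiv_of_isOpen hU (by simp)).clm_apply contDiffOn_const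

/-- Partial derivatives of a smooth function commute. -/
lemma pd_comm {U : Set (Fin 3 → ℝ)} (hU : IsOpen U) {f : (Fin 3 → ℝ) → ℝ}
    (hf : ContDiffOn ℝ (⊤ : ℕ∞) f U) {p : Fin 3 → ℝ} (hp : p ∈ U) (i j : Fin 3) :
    pd j (pd i f) p = pd i (pd j f) p := by
  have hat := hf.contDiffAt (hU.mem_nhds hp)
  have hd : DifferentiableAt ℝ (fderiv ℝ f) p :=
    ((hf.fderiv_of_isOpen hU (m := (⊤ : ℕ∞)) (by simp)).contDiffAt
      (hU.mem_nhds hp)).differentiableAt (by simp)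
  have key : ∀ a b : Fin 3,
      pd b (pd a f) p = fderiv ℝ (fderiv ℝ f) p (Pi.single b 1) (Pi.single a 1) := by
    intro a b
    have h := hd.hasFDerivAt.clm_apply (hasFDerivAt_const (Pi.single a (1 : ℝ)) p)
    have h' : HasFDerivAt (pd a f) _ p := h
    rw [pd, h'.fderiv]
    simp
  rw [key, key]
  exact (hat.isSymmSndFDerivAt (by
    simpa using (WithTop.coe_le_coe.2 le_top :
      ((2 : ℕ∞) : WithTop ℕ∞) ≤ ((⊤ : ℕ∞) : WithTop ℕ∞)))).eq _ _

/-- The Gauss equation in the plane `(i, j)`, cleared of denominators. -/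
def gaussPoly (c ei ej ek xi xj xk bi bj bk ti tj : ℝ) : ℝ :=
  ei * xj * xk * (xj ^ 2 * ti + bi ^ 2 * xj ^ 2 * (2 * xj ^ 2 - 3 * xi * xj - xi ^ 2))
    + ej * xi * xk * (xi ^ 2 * tj + bj ^ 2 * xi ^ 2 * (2 * xi ^ 2 - 3 * xi * xj - xj ^ 2))
    + ek * xi ^ 3 * xj ^ 3 * bk ^ 2 - (xj - xk) * (xk - xi) / 9 + c * xi * xj * xk

lemma hasDerivAt_gaussPoly (c ei ej ek : ℝ) {xi xj xk bi bj bk ti tj : ℝ → ℝ}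
    {xi' xj' xk' bi' bj' bk' ti' tj' s : ℝ}
    (hxi : HasDerivAt xi xi' s) (hxj : HasDerivAt xj xj' s) (hxk : HasDerivAt xk xk' s)
    (hbi : HasDerivAt bi bi' s) (hbj : HasDerivAt bj bj' s) (hbk : HasDerivAt bk bk' s)
    (hti : HasDerivAt ti ti' s) (htj : HasDerivAt tj tj' s) :
    HasDerivAt
      (fun r => gaussPoly c ei ej ek (xi r) (xj r) (xk r) (bi r) (bj r) (bk r) (ti r) (tj r))
      (ei * ((3 * xj s ^ 2 * xj' * xk s + xj s ^ 3 * xk') * ti s + xj s ^ 3 * xk s * ti'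
          + 2 * bi s * bi' * (xj s ^ 3 * xk s * (2 * xj s ^ 2 - 3 * xi s * xj s - xi s ^ 2))
          + bi s ^ 2 * ((3 * xj s ^ 2 * xj' * xk s + xj s ^ 3 * xk')
              * (2 * xj s ^ 2 - 3 * xi s * xj s - xi s ^ 2)
            + xj s ^ 3 * xk s
              * (4 * xj s * xj' - 3 * xi' * xj s - 3 * xi s * xj' - 2 * xi s * xi')))
        + ej * ((3 * xi s ^ 2 * xi' * xk s + xi s ^ 3 * xk') * tj s + xi s ^ 3 * xk s * tj'
          + 2 * bj s * bj' * (xi s ^ 3 * xk s * (2 * xi s ^ 2 - 3 * xi s * xj s - xj s ^ 2))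
          + bj s ^ 2 * ((3 * xi s ^ 2 * xi' * xk s + xi s ^ 3 * xk')
              * (2 * xi s ^ 2 - 3 * xi s * xj s - xj s ^ 2)
            + xi s ^ 3 * xk s
              * (4 * xi s * xi' - 3 * xi' * xj s - 3 * xi s * xj' - 2 * xj s * xj')))
        + ek * (3 * xi s ^ 2 * xi' * xj s ^ 3 * bk s ^ 2 + 3 * xi s ^ 3 * xj s ^ 2 * xj' * bk s ^ 2
          + 2 * xi s ^ 3 * xj s ^ 3 * bk s * bk')
        - ((xj' - xk') * (xk s - xi s) + (xj s - xk s) * (xk' - xi')) / 9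
        + c * (xi' * xj s * xk s + xi s * xj' * xk s + xi s * xj s * xk')) s := by
  have h1 := ((hxj.pow 3).mul hxk).mul (hti.add ((hbi.pow 2).mul
    ((((hxj.pow 2).const_mul 2).sub ((hxi.mul hxj).const_mul 3)).sub (hxi.pow 2))))
  have h2 := ((hxi.pow 3).mul hxk).mul (htj.add ((hbj.pow 2).mul
    ((((hxi.pow 2).const_mul 2).sub ((hxi.mul hxj).const_mul 3)).sub (hxj.pow 2))))
  have h3 := ((hxi.pow 3).mul (hxj.pow 3)).mul (hbk.pow 2)
  have h4 := ((hxj.sub hxk).mul (hxk.sub hxi)).div_const 9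
  have h5 := (hxi.mul hxj).mul hxk
  refine (((((h1.const_mul ei).add (h2.const_mul ej)).add (h3.const_mul ek)).sub h4).add
    (h5.const_mul c)).congr_deriv ?_ |>.congr_of_eventuallyEq (.of_forall fun r => ?_)
  · simp only [Pi.mul_apply, Pi.add_apply, Pi.sub_apply, Pi.pow_apply]
    push_cast
    ring
  · simp only [Pi.mul_apply, Pi.add_apply, Pi.sub_apply, Pi.pow_apply, gaussPoly]
    ring

/-- The holonomic system written in terms of `Xᵢ = ± vᵢ²`, which sum to zero, and of the
single independent first derivative `bᵢ` in each direction. -/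
structure ReducedSystem (U : Set (Fin 3 → ℝ)) (X b : Fin 3 → (Fin 3 → ℝ) → ℝ)
    (e : Fin 3 → ℝ) (c : ℝ) : Prop where
  isOpen : IsOpen U
  smooth_X : ∀ i, ContDiffOn ℝ (⊤ : ℕ∞) (X i) U
  smooth_b : ∀ i, ContDiffOn ℝ (⊤ : ℕ∞) (b i) U
  X_ne : ∀ i, ∀ p ∈ U, X i p ≠ 0
  X_sum : ∀ i j k, i ≠ j → j ≠ k → i ≠ k → ∀ p ∈ U, X i p + X j p + X k p = 0
  pd_X : ∀ i k, i ≠ k → ∀ p ∈ U, pd i (X k) p = 2 * X k p ^ 3 * b i p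
  pd_b : ∀ i j k, i ≠ j → j ≠ k → i ≠ k → ∀ p ∈ U,
    pd j (b i) p = b i p * b j p * (X i p ^ 2 + X j p ^ 2 - 5 * X k p ^ 2)
  gauss : ∀ i j k, i ≠ j → j ≠ k → i ≠ k → ∀ p ∈ U,
    gaussPoly c (e i) (e j) (e k) (X i p) (X j p) (X k p) (b i p) (b j p) (b k p)
      (pd i (b i) p) (pd j (b j) p) = 0

namespace ReducedSystem

variable {U : Set (Fin 3 → ℝ)} {X b : Fin 3 → (Fin 3 → ℝ) → ℝ} {e : Fin 3 → ℝ} {c : ℝ}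

lemma mono (h : ReducedSystem U X b e c) {O : Set (Fin 3 → ℝ)} (hO : IsOpen O) (hOU : O ⊆ U) :
    ReducedSystem O X b e c where
  isOpen := hO
  smooth_X i := (h.smooth_X i).mono hOU
  smooth_b i := (h.smooth_b i).mono hOU
  X_ne i p hp := h.X_ne i p (hOU hp)
  X_sum i j k hij hjk hik p hp := h.X_sum i j k hij hjk hik p (hOU hp)
  pd_X i k hik p hp := h.pd_X i k hik p (hOU hp)
  pd_b i j k hij hjk hik p hp := h.pd_b i j k hij hjk hik p (hOU hp)
  gauss i j k hij hjk hik p hp := h.gauss i j k hij hjk hik p (hOU hp)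

lemma pd_X_self (h : ReducedSystem U X b e c) {i j k : Fin 3} (hij : i ≠ j) (hjk : j ≠ k)
    (hik : i ≠ k) {p : Fin 3 → ℝ} (hp : p ∈ U) :
    pd i (X i) p = -2 * (X j p ^ 3 + X k p ^ 3) * b i p := by
  have hs := ((hasDerivAt_line h.isOpen (h.smooth_X i) hp i).add
    (hasDerivAt_line h.isOpen (h.smooth_X j) hp i)).add
    (hasDerivAt_line h.isOpen (h.smooth_X k) hp i)
  have := line_deriv_unique h.isOpen (f := fun q => X i q + X j q + X k q) (g := fun _ => 0)
    (h.X_sum i j k hij hjk hik) hp i hs (hasDerivAt_const _ _)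
  rw [h.pd_X i j hij p hp, h.pd_X i k hik p hp] at this
  linear_combination this

lemma pd_pd_b (h : ReducedSystem U X b e c) {i j k : Fin 3} (hij : i ≠ j) (hjk : j ≠ k)
    (hik : i ≠ k) {p : Fin 3 → ℝ} (hp : p ∈ U) :
    pd j (pd i (b i)) p =
      b j p * (pd i (b i) p * (X i p ^ 2 + X j p ^ 2 - 5 * X k p ^ 2)
        + b i p ^ 2 * ((X i p ^ 2 + X j p ^ 2 - 5 * X k p ^ 2) ^ 2
          - 4 * X i p * (X j p ^ 3 + X k p ^ 3) + 4 * X j p ^ 4 - 20 * X k p ^ 4)) := by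
  rw [pd_comm h.isOpen (h.smooth_b i) hp]
  have hl := fun l => hasDerivAt_line h.isOpen (h.smooth_X l) hp i
  have hb := fun l => hasDerivAt_line h.isOpen (h.smooth_b l) hp i
  have hd := ((hb i).mul (hb j)).mul
    ((((hl i).pow 2).add ((hl j).pow 2)).sub (((hl k).pow 2).const_mul 5))
  have := line_deriv_unique h.isOpen (h.pd_b i j k hij hjk hik) hp i
    (hasDerivAt_line h.isOpen (contDiffOn_pd h.isOpen (h.smooth_b i) j) hp i) hd
  rw [this, h.pd_X i j hij p hp, h.pd_X i k hik p hp, h.pd_X_self hij hjk hik hp,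
    h.pd_b j i k hij.symm hik hjk p hp]
  simp only [zero_smul, add_zero, Pi.mul_apply, Pi.add_apply, Pi.sub_apply, Pi.pow_apply]
  push_cast
  ring

/-- The Gauss equation of the plane `(i, j)`, differentiated in the direction `i`. -/
lemma gauss_pd (h : ReducedSystem U X b e c) {i j k : Fin 3} (hij : i ≠ j) (hjk : j ≠ k)
    (hik : i ≠ k) {p : Fin 3 → ℝ} (hp : p ∈ U) :
    e i * (X j p ^ 3 * X k p * pd i (pd i (b i)) p
        + b i p * (6 * X j p ^ 2 + 2 * X k p ^ 2) * (X j p ^ 3 * X k p * pd i (b i) p)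
        + 2 * b i p * pd i (b i) p
          * (X j p ^ 3 * X k p * (2 * X j p ^ 2 - 3 * X i p * X j p - X i p ^ 2))
        + b i p ^ 3 * X j p ^ 3 * X k p * ((6 * X j p ^ 2 + 2 * X k p ^ 2)
            * (2 * X j p ^ 2 - 3 * X i p * X j p - X i p ^ 2)
          + 8 * X j p ^ 4 - 6 * X i p * X j p ^ 3
          + (X j p ^ 3 + X k p ^ 3) * (6 * X j p + 4 * X i p)))
      + b i p * (e j * X i p ^ 2 * ((2 * X i p * X k p ^ 3 - 6 * (X j p ^ 3 + X k p ^ 3) * X k p)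
            * (pd j (b j) p
              + b j p ^ 2 * (2 * X i p ^ 2 - 3 * X i p * X j p - X j p ^ 2))
          + X i p * X k p * (pd j (b j) p * (X j p ^ 2 + X i p ^ 2 - 5 * X k p ^ 2)
            + b j p ^ 2 * ((X j p ^ 2 + X i p ^ 2 - 5 * X k p ^ 2) ^ 2
              - 4 * X j p * (X i p ^ 3 + X k p ^ 3) + 4 * X i p ^ 4 - 20 * X k p ^ 4)
            + 2 * b j p ^ 2 * (X j p ^ 2 + X i p ^ 2 - 5 * X k p ^ 2)
              * (2 * X i p ^ 2 - 3 * X i p * X j p - X j p ^ 2)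
            + b j p ^ 2 * ((X j p ^ 3 + X k p ^ 3) * (6 * X j p - 8 * X i p)
              - 6 * X i p * X j p ^ 3 - 4 * X j p ^ 4)))
        + e k * X i p ^ 2 * X j p ^ 3 * b k p ^ 2 * (-6 * (X j p ^ 3 + X k p ^ 3)
          + 6 * X i p * X j p ^ 2 + 2 * X i p * (X k p ^ 2 + X i p ^ 2 - 5 * X j p ^ 2))
        - 2 * ((X j p ^ 3 - X k p ^ 3) * (X k p - X i p)
          + (X j p - X k p) * (2 * X k p ^ 3 + X j p ^ 3)) / 9
        + 2 * c * X j p * X k p * (-(X j p ^ 3 + X k p ^ 3) + X i p * (X j p ^ 2 + X k p ^ 2)))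
      = 0 := by
  have hx := fun l => hasDerivAt_line h.isOpen (h.smooth_X l) hp i
  have hb := fun l => hasDerivAt_line h.isOpen (h.smooth_b l) hp i
  have ht := fun l => hasDerivAt_line h.isOpen (contDiffOn_pd h.isOpen (h.smooth_b l) l) hp i
  have hd := line_deriv_unique h.isOpen (h.gauss i j k hij hjk hik) hp i
    (hasDerivAt_gaussPoly c (e i) (e j) (e k) (hx i) (hx j) (hx k) (hb i) (hb j) (hb k)
      (ht i) (ht j)) (hasDerivAt_const _ _)
  simp only [zero_smul, add_zero] at hd
  rw [h.pd_X i j hij p hp, h.pd_X i k hik p hp, h.pd_X_self hij hjk hik hp,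
    h.pd_b j i k hij.symm hik hjk p hp, h.pd_b k i j hik.symm hij hjk.symm p hp,
    h.pd_pd_b hij.symm hik hjk hp] at hd
  linear_combination hd

/-- Two of the `bᵢ` are nonzero simultaneously only if the ambient curvature vanishes. -/
lemma c_eq_zero (h : ReducedSystem U X b e c) {i j k : Fin 3} (hij : i ≠ j) (hjk : j ≠ k)
    (hik : i ≠ k) {p : Fin 3 → ℝ} (hp : p ∈ U) (hbj : b j p ≠ 0) (hbk : b k p ≠ 0) : c = 0 := by
  have djk := h.gauss_pd hjk hik.symm hij.symm hp
  have dji := h.gauss_pd hij.symm hik hjk hp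
  have dkj := h.gauss_pd hjk.symm hij.symm hik.symm hp
  have dki := h.gauss_pd hik.symm hij hjk.symm hp
  have gjk := h.gauss j k i hjk hik.symm hij.symm p hp
  have gji := h.gauss j i k hij.symm hik hjk p hp
  have gki := h.gauss k i j hik.symm hij hjk.symm p hp
  have hXi := h.X_ne i p hp
  have hXj := h.X_ne j p hp
  have hXk := h.X_ne k p hp
  have hx : X i p = -(X j p + X k p) := by linear_combination h.X_sum i j k hij hjk hik p hp
  have key : b j p * b k p * X i p ^ 3 * X j p ^ 2 * X k p ^ 2 * c = 0 := by
    unfold gaussPoly at gjk gji gki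
    generalize X i p = x at *
    generalize X j p = y at *
    generalize X k p = z at *
    generalize b i p = bi at *
    generalize b j p = bj at *
    generalize b k p = bk at *
    generalize pd i (b i) p = ti at *
    generalize pd j (b j) p = tj at *
    generalize pd k (b k) p = tk at *
    generalize pd j (pd j (b j)) p = uj at *
    generalize pd k (pd k (b k)) p = uk at *
    subst hx
    linear_combination (1 / 24) * (bk * ((y + z) ^ 2 * djk - z ^ 2 * dji)
      + bj * ((y + z) ^ 2 * dkj - y ^ 2 * dki)
      - bj * bk * ((y + z) ^ 2 * gjk * (-19 * y ^ 2 - 40 * y * z - 19 * z ^ 2 + 4 * (y + z) ^ 2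
          + 6 * (3 * z ^ 2 + 3 * y * z + y ^ 2) + 6 * (3 * y ^ 2 + 3 * y * z + z ^ 2)
          + 6 * z ^ 2 + 6 * y ^ 2)
        + z ^ 2 * gji * (15 * z ^ 2 + 10 * y * z - y ^ 2 - (2 * z ^ 2
          + 6 * (3 * z ^ 2 + 3 * y * z + y ^ 2) + 6 * (y + z) ^ 2))
        + y ^ 2 * gki * (15 * y ^ 2 + 10 * y * z - z ^ 2 - (2 * y ^ 2
          + 6 * (3 * y ^ 2 + 3 * y * z + z ^ 2) + 6 * (y + z) ^ 2))))
  simpa [hbj, hbk, hXi, hXj, hXk] using key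

lemma pd_eq_zero_of_forall {f : (Fin 3 → ℝ) → ℝ} (h : ReducedSystem U X b e c) (i : Fin 3)
    (hf : ContDiffOn ℝ (⊤ : ℕ∞) f U) (hf0 : ∀ p ∈ U, f p = 0) {p : Fin 3 → ℝ} (hp : p ∈ U) :
    pd i f p = 0 :=
  line_deriv_unique h.isOpen (g := fun _ => 0) hf0 hp i (hasDerivAt_line h.isOpen hf hp i)
    (hasDerivAt_const _ _)

/-- If two of the `bᵢ` vanish identically, so does the third one. -/
lemma b_eq_zero (h : ReducedSystem U X b e c) {i j k : Fin 3} (hij : i ≠ j) (hjk : j ≠ k)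
    (hik : i ≠ k) (hX : ∀ p ∈ U, X i p ≠ X k p) (hbi : ∀ p ∈ U, b i p = 0)
    (hbk : ∀ p ∈ U, b k p = 0) {p : Fin 3 → ℝ} (hp : p ∈ U) : b j p = 0 := by
  have hrel : ∀ q ∈ U, 9 * c * (X i q * X k q) + 2 * X j q = 0 := by
    intro q hq
    have gik := h.gauss i k j hik hjk.symm hij q hq
    have gij := h.gauss i j k hij hjk hik q hq
    have gkj := h.gauss k j i hjk.symm hij.symm hik.symm q hq
    have hti := h.pd_eq_zero_of_forall i (h.smooth_b i) hbi hq
    have htk := h.pd_eq_zero_of_forall k (h.smooth_b k) hbk hq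
    have hxj : X j q = -(X i q + X k q) := by linear_combination h.X_sum i j k hij hjk hik q hq
    have hXj := h.X_ne j q hq
    simp only [gaussPoly, hti, htk, hbi q hq, hbk q hq] at gik gij gkj
    have key : (X i q - X k q) * X j q ^ 2 * (9 * c * (X i q * X k q) + 2 * X j q) = 0 := by
      rw [hxj] at gik gij gkj ⊢
      linear_combination (3 / 2) * (X k q ^ 2 * gij - X i q ^ 2 * gkj
        - 5 * (X i q ^ 2 - X k q ^ 2) * gik)
    simpa [sub_eq_zero, hX q hq, hXj] using key
  have hx := fun l => hasDerivAt_line h.isOpen (h.smooth_X l) hp j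
  have hd := line_deriv_unique h.isOpen hrel hp j
    ((((hx i).mul (hx k)).const_mul (9 * c)).add ((hx j).const_mul 2)) (hasDerivAt_const _ _)
  simp only [zero_smul, add_zero] at hd
  rw [h.pd_X j i hij.symm p hp, h.pd_X j k hjk p hp, h.pd_X_self hij.symm hik hjk hp] at hd
  have key : X i p * X j p * X k p * b j p = 0 := by
    linear_combination (-1 / 4) * hd
      + (1 / 2) * (X i p ^ 2 + X k p ^ 2) * b j p * hrel p hp
      - (X i p ^ 2 - X i p * X k p + X k p ^ 2) * b j p * h.X_sum i j k hij hjk hik p hp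
  simpa [h.X_ne i p hp, h.X_ne j p hp, h.X_ne k p hp] using key

/-- The `bᵢ` cannot all vanish identically. -/
lemma not_forall_b_eq_zero (h : ReducedSystem U X b e c) (hb : ∀ i, ∀ p ∈ U, b i p = 0)
    {p : Fin 3 → ℝ} (hp : p ∈ U) (hX : X 0 p ≠ X 2 p) : False := by
  have ht := fun i => h.pd_eq_zero_of_forall i (h.smooth_b i) (hb i) hp
  have g01 := h.gauss 0 1 2 (by decide) (by decide) (by decide) p hp
  have g12 := h.gauss 1 2 0 (by decide) (by decide) (by decide) p hp
  have hs := h.X_sum 0 1 2 (by decide) (by decide) (by decide) p hp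
  simp only [gaussPoly, ht, hb _ p hp] at g01 g12
  have key : (X 0 p - X 2 p) * X 1 p = 0 := by
    linear_combination 3 * g01 - 3 * g12 + (1 / 3) * (X 0 p - X 2 p) * hs
  simp [sub_eq_zero, hX, h.X_ne 1 p hp] at key

/-- If the `Xᵢ` are pairwise distinct, the reduced system has no solution with `c ≠ 0`. -/
theorem false_of_injective (h : ReducedSystem U X b e c) (hc : c ≠ 0) (hne : U.Nonempty)
    (hX : ∀ i k, i ≠ k → ∀ p ∈ U, X i p ≠ X k p) : False := by
  by_cases hb : ∀ i, ∀ p ∈ U, b i p = 0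
  · obtain ⟨p, hp⟩ := hne
    exact h.not_forall_b_eq_zero hb hp (hX 0 2 (by decide) p hp)
  push Not at hb
  obtain ⟨j, p, hp, hbj⟩ := hb
  obtain ⟨i, k, hij, hjk, hik⟩ : ∃ i k : Fin 3, i ≠ j ∧ j ≠ k ∧ i ≠ k := by
    clear hbj
    decide +revert
  have hO : IsOpen (U ∩ {q | b j q ≠ 0}) :=
    (h.smooth_b j).continuousOn.isOpen_inter_preimage h.isOpen isOpen_ne
  have hi : ∀ q ∈ U ∩ {q | b j q ≠ 0}, b i q = 0 := fun q hq => by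
    by_contra hbi
    exact hc (h.c_eq_zero hjk.symm hij.symm hik.symm hq.1 hq.2 hbi)
  have hk : ∀ q ∈ U ∩ {q | b j q ≠ 0}, b k q = 0 := fun q hq => by
    by_contra hbk
    exact hc (h.c_eq_zero hij hjk hik hq.1 hq.2 hbk)
  exact hbj ((h.mono hO Set.inter_subset_left).b_eq_zero hij hjk hik
    (fun q hq => hX i k hik q hq.1) hi hk ⟨hp, hbj⟩)

end ReducedSystem

/-- The signs for which `signedSq` sums to zero. -/
def sgn : Fin 3 → ℝ := ![1, -1, 1]

/-- The functions `Xᵢ = ± vᵢ²`. -/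
def signedSq (v : Fin 3 → (Fin 3 → ℝ) → ℝ) (i : Fin 3) (p : Fin 3 → ℝ) : ℝ :=
  sgn i * v i p ^ 2

/-- The logarithmic derivatives in the direction `i` of the two other `vₖ` are `vₖ⁴` times this. -/
def logSlope (v : Fin 3 → (Fin 3 → ℝ) → ℝ) (i : Fin 3) (p : Fin 3 → ℝ) : ℝ :=
  pd i (v (i + 1)) p / v (i + 1) p ^ 5

lemma sgn_sq (i : Fin 3) : sgn i ^ 2 = 1 := by
  fin_cases i <;> simp [sgn]

lemma sgn_ne_zero (i : Fin 3) : sgn i ≠ 0 := by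
  intro h
  simpa [h] using sgn_sq i

lemma signedSq_sq (v : Fin 3 → (Fin 3 → ℝ) → ℝ) (i : Fin 3) (p : Fin 3 → ℝ) :
    signedSq v i p ^ 2 = v i p ^ 4 := by
  rw [signedSq]
  linear_combination v i p ^ 4 * sgn_sq i

lemma sgn_mul_sgn {i j k : Fin 3} (hij : i ≠ j) (hjk : j ≠ k) (hik : i ≠ k) :
    sgn i * sgn j = -sgn k := by
  fin_cases i <;> fin_cases j <;> fin_cases k <;> simp_all [sgn]

lemma cyclic_or_anticyclic (i j k : Fin 3) (hij : i ≠ j) (hjk : j ≠ k) (hik : i ≠ k) :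
    (j = i + 1 ∧ k = i + 2) ∨ (k = i + 1 ∧ j = i + 2) := by
  decide +revert

namespace Hypo

variable {U : Set (Fin 3 → ℝ)} {v V : Fin 3 → (Fin 3 → ℝ) → ℝ} {c : ℝ}

lemma signedSq_sum (h : Hypo U v V c 0) {i j k : Fin 3} (hij : i ≠ j) (hjk : j ≠ k)
    (hik : i ≠ k) {p : Fin 3 → ℝ} (hp : p ∈ U) :
    signedSq v i p + signedSq v j p + signedSq v k p = 0 := by
  have hv := h.ansatz_v p hp
  have h0 : signedSq v 0 p + signedSq v 1 p + signedSq v 2 p = 0 := by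
    simp only [signedSq, sgn, Matrix.cons_val]
    linear_combination -hv
  fin_cases i <;> fin_cases j <;> fin_cases k <;> simp at hij hjk hik <;>
    simp only [Fin.zero_eta, Fin.mk_one, Fin.reduceFinMk] <;> linear_combination h0

lemma three_mul_V (h : Hypo U v V c 0) (i : Fin 3) {p : Fin 3 → ℝ} (hp : p ∈ U) :
    3 * V i p * v (i + 1) p * v (i + 2) p = signedSq v (i + 1) p - signedSq v (i + 2) p := by
  have h0 := (h.pos 0 p hp).ne'
  have h1 := (h.pos 1 p hp).ne'
  have h2 := (h.pos 2 p hp).ne'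
  fin_cases i
  · simp [signedSq, sgn, h.ansatz_V1 p hp]
    field_simp
    ring
  · simp [signedSq, sgn, h.ansatz_V2 p hp]
    field_simp
  · simp [signedSq, sgn, h.ansatz_V3 p hp]
    field_simp

lemma V_mul_V (h : Hypo U v V c 0) {i j k : Fin 3} (hij : i ≠ j) (hjk : j ≠ k)
    (hik : i ≠ k) {p : Fin 3 → ℝ} (hp : p ∈ U) :
    9 * (V i p * V j p) * v i p * v j p * v k p ^ 2
      = (signedSq v j p - signedSq v k p) * (signedSq v k p - signedSq v i p) := by
  have hi := h.three_mul_V i hp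
  have hj := h.three_mul_V j hp
  rcases cyclic_or_anticyclic i j k hij hjk hik with ⟨h1, h2⟩ | ⟨h1, h2⟩
  · have e1 : j + 1 = k := by subst h1 h2; grind
    have e2 : j + 2 = i := by subst h1 h2; grind
    rw [← h1, ← h2] at hi
    rw [e1, e2] at hj
    linear_combination 3 * V j p * v k p * v i p * hi
      + (signedSq v j p - signedSq v k p) * hj
  · have e1 : j + 1 = i := by subst h1 h2; grind
    have e2 : j + 2 = k := by subst h1 h2; grind
    rw [← h1, ← h2] at hi
    rw [e1, e2] at hj
    linear_combination 3 * V j p * v i p * v k p * hi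
      + (signedSq v k p - signedSq v j p) * hj

lemma hasDerivAt_v (h : Hypo U v V c 0) {p : Fin 3 → ℝ} (hp : p ∈ U) (i l : Fin 3) :
    HasDerivAt (fun s : ℝ => v l (p + s • (Pi.single i 1 : Fin 3 → ℝ))) (pd i (v l) p) 0 :=
  hasDerivAt_line h.hopen (h.smooth_v l) hp i

lemma smooth_signedSq (h : Hypo U v V c 0) (i : Fin 3) :
    ContDiffOn ℝ (⊤ : ℕ∞) (signedSq v i) U :=
  contDiffOn_const.mul ((h.smooth_v i).pow 2)

lemma smooth_logSlope (h : Hypo U v V c 0) (i : Fin 3) : ContDiffOn ℝ (⊤ : ℕ∞) (logSlope v i) U :=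
  (contDiffOn_pd h.hopen (h.smooth_v _) i).div ((h.smooth_v _).pow 5)
    fun p hp => pow_ne_zero 5 (h.pos _ p hp).ne'

lemma pd_signedSq (h : Hypo U v V c 0) (i l : Fin 3) {p : Fin 3 → ℝ} (hp : p ∈ U) :
    pd i (signedSq v l) p = 2 * sgn l * v l p * pd i (v l) p := by
  have hd := ((h.hasDerivAt_v hp i l).pow 2).const_mul (sgn l)
  rw [line_deriv_unique h.hopen (fun q _ => rfl) hp i
    (hasDerivAt_line h.hopen (h.smooth_signedSq l) hp i) hd]
  simp
  ring

lemma signedSq_sum_pd (h : Hypo U v V c 0) {i j k : Fin 3} (hij : i ≠ j) (hjk : j ≠ k)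
    (hik : i ≠ k) (l : Fin 3) {p : Fin 3 → ℝ} (hp : p ∈ U) :
    sgn i * v i p * pd l (v i) p + sgn j * v j p * pd l (v j) p
      + sgn k * v k p * pd l (v k) p = 0 := by
  have hs := fun m => hasDerivAt_line h.hopen (h.smooth_signedSq m) hp l
  have := line_deriv_unique h.hopen (fun q hq => h.signedSq_sum hij hjk hik hq) hp l
    (((hs i).add (hs j)).add (hs k)) (hasDerivAt_const _ _)
  simp only [h.pd_signedSq l _ hp] at this
  linear_combination this / 2

/-- The Codazzi equations make the first derivatives in each direction proportional. -/
lemma pd_v_proportional (h : Hypo U v V c 0) {i j k : Fin 3} (hj : j = i + 1) (hk : k = i + 2)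
    {p : Fin 3 → ℝ} (hp : p ∈ U) :
    v j p ^ 5 * pd i (v k) p = v k p ^ 5 * pd i (v j) p := by
  have hij : i ≠ j := by subst hj; decide +revert
  have hjk : j ≠ k := by subst hj hk; decide +revert
  have hik : i ≠ k := by subst hk; decide +revert
  have e1 : j + 1 = k := by subst hj hk; decide +revert
  have e2 : j + 2 = i := by subst hj; decide +revert
  have hsum := h.signedSq_sum_pd hij hjk hik i hp
  have hX := h.signedSq_sum hij hjk hik hp
  have hV := h.three_mul_V i hp
  have hVj := fun q (hq : q ∈ U) => h.three_mul_V j hq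
  simp only [e1, e2] at hVj
  rw [← hj, ← hk] at hV
  have hVp := hVj p hp
  have hcod := h.holiv j i hij.symm p hp
  have hs := fun m => hasDerivAt_line h.hopen (h.smooth_signedSq m) hp i
  have hd := line_deriv_unique h.hopen hVj hp i
    ((((hasDerivAt_line h.hopen (h.smooth_V j) hp i).const_mul 3).mul
      (h.hasDerivAt_v hp i k)).mul (h.hasDerivAt_v hp i i)) ((hs k).sub (hs i))
  simp only [zero_smul, add_zero, Pi.mul_apply, h.pd_signedSq i _ hp, hcod, hh] at hd
  have hvi := (h.pos i p hp).ne'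
  have hcancel : 1 / v i p * v i p = 1 := by field_simp
  have hk2 := signedSq_sq v k p
  have hj2 := signedSq_sq v j p
  have hxi : signedSq v i p = sgn i * v i p ^ 2 := rfl
  have hxj : signedSq v j p = sgn j * v j p ^ 2 := rfl
  have hxk : signedSq v k p = sgn k * v k p ^ 2 := rfl
  have hE : pd i (v j) p * v i p * v k p * (signedSq v j p - signedSq v k p)
      + pd i (v k) p * v i p * v j p * signedSq v j p
      - pd i (v i) p * v j p * v k p * signedSq v j p = 0 := by
    linear_combination v i p * v j p * v k p * hd
      - 3 * pd i (v j) p * V i p * v i p * v j p * v k p ^ 2 * hcancel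
      - pd i (v j) p * v i p * v k p * hV
      - (pd i (v k) p * v i p * v j p + pd i (v i) p * v j p * v k p) * hVp
      + (pd i (v k) p * v i p * v j p - pd i (v i) p * v j p * v k p) * hX
      - 2 * v i p * v j p * pd i (v k) p * hxk + 2 * pd i (v i) p * v j p * v k p * hxi
  linear_combination (-(sgn i) * v i p) * hE - v j p * v k p * signedSq v j p * hsum
    - (pd i (v j) p * v k p * (signedSq v j p - signedSq v k p)
      + pd i (v k) p * v j p * signedSq v j p) * hxi
    - v k p * pd i (v j) p * signedSq v j p * hxj - v j p * signedSq v j p * pd i (v k) p * hxk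
    + (pd i (v k) p * v j p * signedSq v j p
      + pd i (v j) p * v k p * (signedSq v j p - signedSq v k p)) * hX
    - pd i (v k) p * v j p * hj2 + pd i (v j) p * v k p * hk2

lemma pd_v (h : Hypo U v V c 0) {i k : Fin 3} (hik : i ≠ k) {p : Fin 3 → ℝ} (hp : p ∈ U) :
    pd i (v k) p = v k p ^ 5 * logSlope v i p := by
  have hj := (h.pos (i + 1) p hp).ne'
  have hc : k = i + 1 ∨ k = i + 2 := by clear hj; decide +revert
  rw [logSlope]
  rcases hc with rfl | rfl
  · field_simp
  · have := h.pd_v_proportional rfl rfl hp (i := i)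
    field_simp
    linear_combination this

lemma pd_v_self (h : Hypo U v V c 0) {i j k : Fin 3} (hij : i ≠ j) (hjk : j ≠ k) (hik : i ≠ k)
    {p : Fin 3 → ℝ} (hp : p ∈ U) :
    pd i (v i) p = v i p * (signedSq v j p ^ 2 - signedSq v j p * signedSq v k p
      + signedSq v k p ^ 2) * logSlope v i p := by
  have hsum := h.signedSq_sum_pd hij hjk hik i hp
  rw [h.pd_v hij hp, h.pd_v hik hp] at hsum
  have hX := h.signedSq_sum hij hjk hik hp
  have hj := signedSq_sq v j p
  have hk := signedSq_sq v k p
  have hvi := (h.pos i p hp).ne'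
  have key : sgn i * v i p * (pd i (v i) p - v i p * (signedSq v j p ^ 2
      - signedSq v j p * signedSq v k p + signedSq v k p ^ 2) * logSlope v i p) = 0 := by
    have hxi : signedSq v i p = sgn i * v i p ^ 2 := rfl
    have hxj : signedSq v j p = sgn j * v j p ^ 2 := rfl
    have hxk : signedSq v k p = sgn k * v k p ^ 2 := rfl
    linear_combination hsum - (signedSq v j p ^ 2 - signedSq v j p * signedSq v k p
        + signedSq v k p ^ 2) * logSlope v i p * hX
      + (signedSq v j p ^ 2 - signedSq v j p * signedSq v k p
        + signedSq v k p ^ 2) * logSlope v i p * hxi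
      + v j p ^ 4 * logSlope v i p * hxj + v k p ^ 4 * logSlope v i p * hxk
      + signedSq v j p * logSlope v i p * hj + signedSq v k p * logSlope v i p * hk
  simpa [sgn_ne_zero, hvi, sub_eq_zero] using key

lemma mul_hh (h : Hypo U v V c 0) {i j : Fin 3} (hij : i ≠ j) {p : Fin 3 → ℝ} (hp : p ∈ U) :
    v i p * hh v i j p = v j p ^ 5 * logSlope v i p := by
  have hvi := (h.pos i p hp).ne'
  rw [hh, h.pd_v hij hp]
  field_simp

lemma smooth_hh (h : Hypo U v V c 0) (i j : Fin 3) : ContDiffOn ℝ (⊤ : ℕ∞) (hh v i j) U :=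
  (contDiffOn_const.div (h.smooth_v i) fun p hp => (h.pos i p hp).ne').mul
    (contDiffOn_pd h.hopen (h.smooth_v j) i)

/-- The product rule applied to `mul_hh`. -/
lemma pd_hh (h : Hypo U v V c 0) {i j : Fin 3} (hij : i ≠ j) (l : Fin 3) {p : Fin 3 → ℝ}
    (hp : p ∈ U) :
    pd l (v i) p * hh v i j p + v i p * pd l (hh v i j) p
      = 5 * v j p ^ 4 * pd l (v j) p * logSlope v i p + v j p ^ 5 * pd l (logSlope v i) p := by
  have := line_deriv_unique h.hopen (fun q hq => h.mul_hh hij hq) hp l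
    ((h.hasDerivAt_v hp l i).mul (hasDerivAt_line h.hopen (h.smooth_hh i j) hp l))
    (((h.hasDerivAt_v hp l j).pow 5).mul (hasDerivAt_line h.hopen (h.smooth_logSlope i) hp l))
  simpa using this

lemma pd_logSlope (h : Hypo U v V c 0) {i j k : Fin 3} (hij : i ≠ j) (hjk : j ≠ k) (hik : i ≠ k)
    {p : Fin 3 → ℝ} (hp : p ∈ U) :
    pd j (logSlope v i) p = logSlope v i p * logSlope v j p
      * (signedSq v i p ^ 2 + signedSq v j p ^ 2 - 5 * signedSq v k p ^ 2) := by
  have hd := h.pd_hh hik j hp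
  rw [h.holii i j k hij hjk hik p hp, h.pd_v hij.symm hp, h.pd_v hjk hp] at hd
  have hvj := (h.pos j p hp).ne'
  have hvk := (h.pos k p hp).ne'
  have mik := h.mul_hh hik hp
  have mij := h.mul_hh hij hp
  have mjk := h.mul_hh hjk hp
  rw [signedSq_sq, signedSq_sq, signedSq_sq]
  have key : v j p * v k p ^ 5 * (pd j (logSlope v i) p - logSlope v i p * logSlope v j p
      * (v i p ^ 4 + v j p ^ 4 - 5 * v k p ^ 4)) = 0 := by
    linear_combination -v j p * hd + v i p ^ 4 * logSlope v j p * v j p * mik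
      + v j p * hh v j k p * mij + v j p ^ 5 * logSlope v i p * mjk
  simpa [hvj, hvk, sub_eq_zero] using key

lemma gauss (h : Hypo U v V c 0) {i j k : Fin 3} (hij : i ≠ j) (hjk : j ≠ k) (hik : i ≠ k)
    {p : Fin 3 → ℝ} (hp : p ∈ U) :
    gaussPoly c (sgn i) (sgn j) (sgn k) (signedSq v i p) (signedSq v j p) (signedSq v k p)
      (logSlope v i p) (logSlope v j p) (logSlope v k p)
      (pd i (logSlope v i) p) (pd j (logSlope v j) p) = 0 := by
  have hg := h.holiii i j k hij hjk hik p hp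
  have dij := h.pd_hh hij i hp
  have dji := h.pd_hh hij.symm j hp
  rw [h.pd_v hij hp, h.pd_v_self hij hjk hik hp] at dij
  rw [h.pd_v hij.symm hp, h.pd_v_self hij.symm hik hjk hp] at dji
  have mij := h.mul_hh hij hp
  have mji := h.mul_hh hij.symm hp
  have mki := h.mul_hh hik.symm hp
  have mkj := h.mul_hh hjk.symm hp
  have hV := h.V_mul_V hij hjk hik hp
  have hX := h.signedSq_sum hij hjk hik hp
  have si : sgn i * signedSq v j p * signedSq v k p = -(v j p ^ 2 * v k p ^ 2) := by
    simp only [signedSq]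
    linear_combination v j p ^ 2 * v k p ^ 2 * sgn k * sgn_mul_sgn hij hjk hik
      - v j p ^ 2 * v k p ^ 2 * sgn_sq k
  have sj : sgn j * signedSq v i p * signedSq v k p = -(v i p ^ 2 * v k p ^ 2) := by
    simp only [signedSq]
    linear_combination v i p ^ 2 * v k p ^ 2 * sgn k * sgn_mul_sgn hij hjk hik
      - v i p ^ 2 * v k p ^ 2 * sgn_sq k
  have sk : sgn k * signedSq v i p * signedSq v j p = -(v i p ^ 2 * v j p ^ 2) := by
    simp only [signedSq]
    linear_combination v i p ^ 2 * v j p ^ 2 * sgn k * sgn_mul_sgn hij hjk hik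
      - v i p ^ 2 * v j p ^ 2 * sgn_sq k
  have s3 : signedSq v i p * signedSq v j p * signedSq v k p
      = -(v i p ^ 2 * v j p ^ 2 * v k p ^ 2) := by
    have : signedSq v k p = sgn k * v k p ^ 2 := rfl
    rw [this]
    linear_combination v k p ^ 2 * sk
  have hi := signedSq_sq v i p
  have hj := signedSq_sq v j p
  have Aij : v i p * pd i (hh v i j) p = v j p ^ 5 * (pd i (logSlope v i) p
      + logSlope v i p ^ 2 * (2 * signedSq v j p ^ 2 - 3 * signedSq v i p * signedSq v j p
        - signedSq v i p ^ 2)) := by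
    linear_combination dij - (signedSq v j p ^ 2 - signedSq v j p * signedSq v k p
        + signedSq v k p ^ 2) * logSlope v i p * mij
      - 5 * v j p ^ 5 * logSlope v i p ^ 2 * hj
      + v j p ^ 5 * logSlope v i p ^ 2
        * (signedSq v i p + 2 * signedSq v j p - signedSq v k p) * hX
  have Aji : v j p * pd j (hh v j i) p = v i p ^ 5 * (pd j (logSlope v j) p
      + logSlope v j p ^ 2 * (2 * signedSq v i p ^ 2 - 3 * signedSq v i p * signedSq v j p
        - signedSq v j p ^ 2)) := by
    linear_combination dji - (signedSq v i p ^ 2 - signedSq v i p * signedSq v k p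
        + signedSq v k p ^ 2) * logSlope v j p * mji
      - 5 * v i p ^ 5 * logSlope v j p ^ 2 * hi
      + v i p ^ 5 * logSlope v j p ^ 2
        * (signedSq v j p + 2 * signedSq v i p - signedSq v k p) * hX
  unfold gaussPoly
  set Bi := pd i (logSlope v i) p + logSlope v i p ^ 2 * (2 * signedSq v j p ^ 2
    - 3 * signedSq v i p * signedSq v j p - signedSq v i p ^ 2) with hBi
  set Bj := pd j (logSlope v j) p + logSlope v j p ^ 2 * (2 * signedSq v i p ^ 2
    - 3 * signedSq v i p * signedSq v j p - signedSq v j p ^ 2) with hBj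
  linear_combination -(v i p * v j p * v k p ^ 2) * hg + v j p * v k p ^ 2 * Aij
    + v i p * v k p ^ 2 * Aji
    + v i p * v j p * (v k p * hh v k j p * mki + v i p ^ 5 * logSlope v k p * mkj)
    + hV / 9 + signedSq v j p ^ 2 * Bi * si - v j p ^ 2 * v k p ^ 2 * Bi * hj
    + signedSq v i p ^ 2 * Bj * sj - v i p ^ 2 * v k p ^ 2 * Bj * hi
    + signedSq v i p ^ 2 * signedSq v j p ^ 2 * logSlope v k p ^ 2 * sk
    - v i p ^ 2 * v j p ^ 2 * logSlope v k p ^ 2 * (signedSq v j p ^ 2 * hi + v i p ^ 4 * hj)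
    + c * s3
    - sgn i * signedSq v j p ^ 3 * signedSq v k p * hBi
    - sgn j * signedSq v i p ^ 3 * signedSq v k p * hBj

lemma reducedSystem (h : Hypo U v V c 0) :
    ReducedSystem U (signedSq v) (logSlope v) sgn c where
  isOpen := h.hopen
  smooth_X := h.smooth_signedSq
  smooth_b := h.smooth_logSlope
  X_ne i p hp := mul_ne_zero (sgn_ne_zero i) (pow_ne_zero 2 (h.pos i p hp).ne')
  X_sum i j k hij hjk hik p hp := h.signedSq_sum hij hjk hik hp
  pd_X i k hik p hp := by
    rw [h.pd_signedSq i k hp, h.pd_v hik hp, signedSq]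
    linear_combination -2 * sgn k * v k p ^ 6 * logSlope v i p * sgn_sq k
  pd_b i j k hij hjk hik p hp := h.pd_logSlope hij hjk hik hp
  gauss i j k hij hjk hik p hp := h.gauss hij hjk hik hp

end Hypo

theorem statement_11 (U : Set (Fin 3 → ℝ)) (v V : Fin 3 → (Fin 3 → ℝ) → ℝ) (c H : ℝ)
    (hyp : Hypo U v V c H) : H = 0 → c ≠ 0 →
    (∀ p ∈ U, v 0 p = v 2 p) ∧ (∀ p ∈ U, V 1 p = 0) := by
  rintro rfl hc
  have hv : ∀ p ∈ U, v 0 p = v 2 p := by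
    by_contra! hne
    obtain ⟨p, hp, hpne⟩ := hne
    have hO : IsOpen (U ∩ {q | v 0 q - v 2 q ≠ 0}) :=
      ((hyp.smooth_v 0).continuousOn.sub (hyp.smooth_v 2).continuousOn).isOpen_inter_preimage
        hyp.hopen isOpen_ne
    refine (hyp.reducedSystem.mono hO Set.inter_subset_left).false_of_injective hc
      ⟨p, hp, sub_ne_zero.2 hpne⟩ fun i k hik q hq heq => ?_
    have h0 := hyp.pos 0 q hq.1
    have h1 := hyp.pos 1 q hq.1
    have h2 := hyp.pos 2 q hq.1
    have hq2 : v 0 q ≠ v 2 q := sub_ne_zero.1 hq.2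
    have h02 : v 0 q ^ 2 ≠ v 2 q ^ 2 := fun h => hq2 ((sq_eq_sq₀ h0.le h2.le).1 h)
    have h20 := h02.symm
    fin_cases i <;> fin_cases k <;> simp [signedSq, sgn] at hik heq <;>
      first | exact h02 heq | exact h20 heq | nlinarith
  refine ⟨hv, fun p hp => ?_⟩
  rw [hyp.ansatz_V2 p hp, hv p hp]
  simp
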